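/- arXiv:1701.01254 — 4 statements merged into one kernel-verified Lean document; each statement's English description precedes it below -/
import Mathlib

section
/- Karamata's Tauberian Lemma: Let ν be a non-negative Borel measure on (0,∞) and let α ≥ 1. Assume that ∫₀^∞ e^{-tλ} dν(λ) < ∞ for all t > 0, and that lim_{t→0⁺} t^α ∫₀^∞ e^{-tλ} dν(λ) = c for some c ∈ (0,∞). Then for every continuous function g on [0,1], lim_{t→0⁺} t^α ∫₀^∞ g(e^{-tλ}) e^{-tλ} dν(λ) = (c/Γ(α)) ∫₀^∞ g(e^{-s}) s^{α-1} e^{-s} ds. -/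
open MeasureTheory Filter Topology Set

section WeightedIntegral

variable {μ : Measure ℝ} {u w g h : ℝ → ℝ}

lemma integrableOn_comp_mul (hu : ContinuousOn u (Ioi 0)) (hu' : MapsTo u (Ioi 0) (Icc 0 1))
    (hw : IntegrableOn w (Ioi 0) μ) (hg : ContinuousOn g (Icc 0 1)) :
    IntegrableOn (fun x => g (u x) * w x) (Ioi 0) μ := by
  obtain ⟨C, hC⟩ := isCompact_Icc.exists_bound_of_continuousOn hg
  refine Integrable.bdd_mul (c := C) hw
    ((hg.comp hu hu').aestronglyMeasurable measurableSet_Ioi) ?_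
  filter_upwards [ae_restrict_mem measurableSet_Ioi] with x hx using hC _ (hu' hx)

lemma abs_integral_comp_mul_sub_le (hu : ContinuousOn u (Ioi 0))
    (hu' : MapsTo u (Ioi 0) (Icc 0 1)) (hw : IntegrableOn w (Ioi 0) μ)
    (hw' : ∀ x ∈ Ioi (0 : ℝ), 0 ≤ w x)
    (hg : ContinuousOn g (Icc 0 1)) (hh : ContinuousOn h (Icc 0 1)) {δ : ℝ}
    (hδ : ∀ x ∈ Icc (0 : ℝ) 1, |g x - h x| ≤ δ) :
    |∫ x in Ioi 0, g (u x) * w x ∂μ - ∫ x in Ioi 0, h (u x) * w x ∂μ|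
      ≤ δ * ∫ x in Ioi 0, w x ∂μ := by
  rw [← integral_sub (integrableOn_comp_mul hu hu' hw hg) (integrableOn_comp_mul hu hu' hw hh),
    ← integral_const_mul, ← Real.norm_eq_abs]
  refine norm_integral_le_of_norm_le (hw.const_mul δ) ?_
  filter_upwards [ae_restrict_mem measurableSet_Ioi] with x hx
  rw [← sub_mul, norm_mul, Real.norm_eq_abs, Real.norm_of_nonneg (hw' x hx)]
  exact mul_le_mul_of_nonneg_right (hδ _ (hu' hx)) (hw' x hx)

end WeightedIntegral

lemma mapsTo_exp_neg_mul {t : ℝ} (ht : 0 < t) :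
    MapsTo (fun l : ℝ => Real.exp (-t * l)) (Ioi 0) (Icc 0 1) := by
  intro l hl
  refine ⟨(Real.exp_pos _).le, Real.exp_le_one_iff.2 ?_⟩
  have := mul_pos ht hl
  linarith

lemma mapsTo_exp_neg : MapsTo (fun s : ℝ => Real.exp (-s)) (Ioi 0) (Icc 0 1) := by
  simpa using mapsTo_exp_neg_mul one_pos

lemma continuousOn_exp_neg_mul (t : ℝ) :
    ContinuousOn (fun l : ℝ => Real.exp (-t * l)) (Ioi 0) := by
  fun_prop

lemma continuousOn_exp_neg : ContinuousOn (fun s : ℝ => Real.exp (-s)) (Ioi 0) := by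
  fun_prop

lemma integrableOn_rpow_mul_exp_neg {α : ℝ} (hα : 0 < α) :
    IntegrableOn (fun s : ℝ => s ^ (α - 1) * Real.exp (-s)) (Ioi 0) := by
  simpa only [mul_comm] using Real.GammaIntegral_convergent hα

lemma integral_rpow_mul_exp_neg {α : ℝ} (hα : 0 < α) :
    ∫ s in Ioi (0 : ℝ), s ^ (α - 1) * Real.exp (-s) = Real.Gamma α := by
  simp only [Real.Gamma_eq_integral hα, mul_comm]

/-- The Tauberian limit for the test function `a * x ^ n`. -/
lemma tendsto_laplace_monomial {ν : Measure ℝ} {α c : ℝ} (hα : 0 < α)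
    (hlim : Tendsto (fun t : ℝ => t ^ α * ∫ l in Ioi (0 : ℝ), Real.exp (-t * l) ∂ν)
      (𝓝[>] 0) (𝓝 c)) (n : ℕ) (a : ℝ) :
    Tendsto
      (fun t : ℝ => t ^ α *
        ∫ l in Ioi (0 : ℝ), (a * Real.exp (-t * l) ^ n) * Real.exp (-t * l) ∂ν)
      (𝓝[>] 0)
      (𝓝 ((c / Real.Gamma α) *
        ∫ s in Ioi (0 : ℝ), (a * Real.exp (-s) ^ n) * (s ^ (α - 1) * Real.exp (-s)))) := by
  have hn : (0 : ℝ) < n + 1 := by positivity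
  have hexp (x : ℝ) : Real.exp x ^ n * Real.exp x = Real.exp ((n + 1) * x) := by
    rw [← Real.exp_nat_mul, ← Real.exp_add]
    ring_nf
  have hR : ∫ s in Ioi (0 : ℝ), (a * Real.exp (-s) ^ n) * (s ^ (α - 1) * Real.exp (-s))
      = a * ((1 / (n + 1)) ^ α * Real.Gamma α) := by
    rw [← Real.integral_rpow_mul_exp_neg_mul_Ioi hα hn, ← integral_const_mul]
    refine integral_congr_ae (Eventually.of_forall fun s => ?_)
    have := hexp (-s)
    rw [mul_neg] at this
    simp only [← this]
    ring
  have hscale : Tendsto (fun t : ℝ => (n + 1) * t) (𝓝[>] 0) (𝓝[>] 0) := by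
    refine tendsto_nhdsWithin_iff.2 ⟨?_, ?_⟩
    · refine Tendsto.mono_left ?_ nhdsWithin_le_nhds
      simpa using (continuous_const_mul ((n : ℝ) + 1)).tendsto 0
    · filter_upwards [self_mem_nhdsWithin] with t ht using mul_pos hn ht
  have hmain := (hlim.comp hscale).const_mul (a * (1 / (n + 1)) ^ α)
  have hΓ := (Real.Gamma_pos_of_pos hα).ne'
  rw [hR, show c / Real.Gamma α * (a * ((1 / ((n : ℝ) + 1)) ^ α * Real.Gamma α))
    = a * (1 / (n + 1)) ^ α * c by field_simp]
  refine hmain.congr' ?_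
  filter_upwards [self_mem_nhdsWithin] with t ht
  have hpow : (1 / ((n : ℝ) + 1)) ^ α * ((n + 1) * t) ^ α = t ^ α := by
    rw [← Real.mul_rpow (by positivity) (mul_pos hn ht).le]
    congr 1
    field_simp
  have hint : ∫ l in Ioi (0 : ℝ), (a * Real.exp (-t * l) ^ n) * Real.exp (-t * l) ∂ν
      = a * ∫ l in Ioi (0 : ℝ), Real.exp (-((n + 1) * t) * l) ∂ν := by
    rw [← integral_const_mul]
    refine integral_congr_ae (Eventually.of_forall fun l => ?_)
    simp only [mul_assoc a, hexp]
    ring_nf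
  simp only [Function.comp, hint]
  rw [← hpow]
  ring

lemma tendsto_laplace_polynomial {ν : Measure ℝ} {α c : ℝ} (hα : 0 < α)
    (hfin : ∀ t : ℝ, 0 < t → IntegrableOn (fun l : ℝ => Real.exp (-t * l)) (Ioi 0) ν)
    (hlim : Tendsto (fun t : ℝ => t ^ α * ∫ l in Ioi (0 : ℝ), Real.exp (-t * l) ∂ν)
      (𝓝[>] 0) (𝓝 c)) (p : Polynomial ℝ) :
    Tendsto
      (fun t : ℝ => t ^ α *
        ∫ l in Ioi (0 : ℝ), p.eval (Real.exp (-t * l)) * Real.exp (-t * l) ∂ν)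
      (𝓝[>] 0)
      (𝓝 ((c / Real.Gamma α) *
        ∫ s in Ioi (0 : ℝ), p.eval (Real.exp (-s)) * (s ^ (α - 1) * Real.exp (-s)))) := by
  induction p using Polynomial.induction_on' with
  | monomial n a => simpa only [Polynomial.eval_monomial] using
      tendsto_laplace_monomial hα hlim n a
  | add p q hp hq =>
    have hsum := hp.add hq
    have hw := integrableOn_rpow_mul_exp_neg hα
    rw [← mul_add, ← integral_add
      (integrableOn_comp_mul continuousOn_exp_neg mapsTo_exp_neg hw p.continuousOn)
      (integrableOn_comp_mul continuousOn_exp_neg mapsTo_exp_neg hw q.continuousOn)] at hsum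
    simp only [Polynomial.eval_add, add_mul]
    refine hsum.congr' ?_
    filter_upwards [self_mem_nhdsWithin] with t ht
    rw [← mul_add, ← integral_add
      (integrableOn_comp_mul (continuousOn_exp_neg_mul t) (mapsTo_exp_neg_mul ht) (hfin t ht)
        p.continuousOn)
      (integrableOn_comp_mul (continuousOn_exp_neg_mul t) (mapsTo_exp_neg_mul ht) (hfin t ht)
        q.continuousOn)]

/-- Karamata's Tauberian Lemma. -/
theorem karamata_tauberian
    (ν : Measure ℝ) (α : ℝ) (hα : 1 ≤ α) (c : ℝ) (hc : 0 < c)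
    (hfin : ∀ t : ℝ, 0 < t →
      IntegrableOn (fun l : ℝ => Real.exp (-t * l)) (Set.Ioi 0) ν)
    (hlim : Tendsto
      (fun t : ℝ => t ^ α * ∫ l in Set.Ioi (0:ℝ), Real.exp (-t * l) ∂ν)
      (𝓝[>] 0) (𝓝 c))
    (g : ℝ → ℝ) (hg : ContinuousOn g (Set.Icc 0 1)) :
    Tendsto
      (fun t : ℝ => t ^ α *
        ∫ l in Set.Ioi (0:ℝ), g (Real.exp (-t * l)) * Real.exp (-t * l) ∂ν)
      (𝓝[>] 0)
      (𝓝 ((c / Real.Gamma α) *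
        ∫ s in Set.Ioi (0:ℝ), g (Real.exp (-s)) * s ^ (α - 1) * Real.exp (-s))) := by
  have hα0 : 0 < α := by linarith
  have hΓ := Real.Gamma_pos_of_pos hα0
  simp only [mul_assoc (g _)]
  rw [Metric.tendsto_nhds]
  intro ε hε
  obtain ⟨δ, hδ, hδε⟩ : ∃ δ > 0, δ * (c + 1) = ε / 3 :=
    ⟨ε / 3 / (c + 1), by positivity, by field_simp⟩
  obtain ⟨p, hp⟩ := exists_polynomial_near_of_continuousOn 0 1 g hg δ hδ
  have hright := abs_integral_comp_mul_sub_le continuousOn_exp_neg mapsTo_exp_neg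
    (integrableOn_rpow_mul_exp_neg hα0)
    (fun s hs => mul_nonneg (Real.rpow_nonneg (le_of_lt hs) _) (Real.exp_pos _).le)
    p.continuousOn hg (fun x hx => (hp x hx).le)
  rw [integral_rpow_mul_exp_neg hα0] at hright
  have hright' := mul_le_mul_of_nonneg_left hright (div_pos hc hΓ).le
  rw [← abs_of_pos (div_pos hc hΓ), ← abs_mul, abs_of_pos (div_pos hc hΓ), mul_sub,
    show c / Real.Gamma α * (δ * Real.Gamma α) = δ * c by field_simp] at hright'
  filter_upwards [self_mem_nhdsWithin, hlim.eventually_lt_const (lt_add_one c),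
    Metric.tendsto_nhds.1 (tendsto_laplace_polynomial hα0 hfin hlim p) (ε / 3) (by positivity)]
    with t ht hbound hpoly
  have htα : 0 < t ^ α := Real.rpow_pos_of_pos ht α
  have hleft := mul_le_mul_of_nonneg_left
    (abs_integral_comp_mul_sub_le (continuousOn_exp_neg_mul t) (mapsTo_exp_neg_mul ht)
      (hfin t ht) (fun _ _ => (Real.exp_pos _).le) p.continuousOn hg
      (fun x hx => (hp x hx).le)) htα.le
  rw [← abs_of_pos htα, ← abs_mul, abs_of_pos htα, mul_sub, mul_left_comm] at hleft
  have hleft' := hleft.trans (mul_le_mul_of_nonneg_left hbound.le hδ.le)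
  rw [Real.dist_eq, abs_lt] at *
  rw [abs_le] at hleft' hright'
  constructor <;> linarith [hpoly.1, hpoly.2, hleft'.1, hleft'.2, hright'.1, hright'.2]
end

section
/- Weyl's law from heat trace asymptotics (abstract form of Corollary 1.2): Let n ≥ 2 be an integer and V₀ > 0 a real number. Let (λ_k)_{k≥1} be a sequence of real numbers that is bounded below, tends to +∞, and satisfies: the series Σ_{k≥1} e^{-tλ_k} converges for every t > 0, and lim_{t→0⁺} t^{n/2} Σ_{k≥1} e^{-tλ_k} = V₀ / (4π)^{n/2}. Define the counting function N(Λ) = #{k : λ_k ≤ Λ}. Then lim_{Λ→∞} N(Λ) (2π)^n / (Λ^{n/2} ω_n) = V₀, where ω_n = π^{n/2}/Γ(n/2 + 1) is the volume of the unit ball in ℝⁿ. -/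
open MeasureTheory Filter Topology Set

/-- The trace functional `∑ e^{-tλ} g(e^{-tλ})` of a sequence, tested against a function `g`. -/
noncomputable def heatSum (lam : ℕ → ℝ) (g : ℝ → ℝ) (t : ℝ) : ℝ :=
  ∑' k, Real.exp (-t * lam k) * g (Real.exp (-t * lam k))

/-- The integral of `g (e^{-s})` against the Gamma density `e^{-s} s^{a-1}` on `(0, ∞)`. -/
noncomputable def gammaIntegral (a : ℝ) (g : ℝ → ℝ) : ℝ :=
  ∫ s in Ioi (0 : ℝ), Real.exp (-s) * s ^ (a - 1) * g (Real.exp (-s))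

lemma Continuous.exists_abs_le_on_unitInterval {g : ℝ → ℝ} (hg : Continuous g) :
    ∃ C, ∀ x ∈ Icc (0 : ℝ) 1, |g x| ≤ C :=
  isCompact_Icc.exists_bound_of_continuousOn hg.continuousOn

lemma exp_neg_mul_mem_Icc {t x : ℝ} (ht : 0 < t) (hx : 0 ≤ x) :
    Real.exp (-t * x) ∈ Icc (0 : ℝ) 1 :=
  ⟨(Real.exp_pos _).le, Real.exp_le_one_iff.2 (by nlinarith)⟩

lemma exp_neg_mem_Icc {s : ℝ} (hs : s ∈ Ioi (0 : ℝ)) : Real.exp (-s) ∈ Icc (0 : ℝ) 1 :=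
  ⟨(Real.exp_pos _).le, Real.exp_le_one_iff.2 (neg_nonpos.2 (le_of_lt hs))⟩

lemma summable_heatSum {lam : ℕ → ℝ} (h0 : ∀ k, 0 ≤ lam k) {t : ℝ} (ht : 0 < t)
    (hsum : Summable fun k => Real.exp (-t * lam k)) {g : ℝ → ℝ} (hg : Continuous g) :
    Summable fun k => Real.exp (-t * lam k) * g (Real.exp (-t * lam k)) := by
  obtain ⟨C, hC⟩ := hg.exists_abs_le_on_unitInterval
  refine Summable.of_norm_bounded (hsum.mul_right C) fun k => ?_
  rw [norm_mul, Real.norm_eq_abs, Real.norm_eq_abs, Real.abs_exp]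
  exact mul_le_mul_of_nonneg_left (hC _ (exp_neg_mul_mem_Icc ht (h0 k))) (Real.exp_pos _).le

lemma integrableOn_gammaIntegral {a : ℝ} (ha : 0 < a) {g : ℝ → ℝ} (hg : Continuous g) :
    IntegrableOn (fun s => Real.exp (-s) * s ^ (a - 1) * g (Real.exp (-s))) (Ioi 0) := by
  obtain ⟨C, hC⟩ := hg.exists_abs_le_on_unitInterval
  refine Integrable.mul_bdd (Real.GammaIntegral_convergent ha) (c := C) ?_ ?_
  · exact Continuous.aestronglyMeasurable (by fun_prop)
  · exact (ae_restrict_iff' measurableSet_Ioi).2 (ae_of_all _ fun s hs => hC _ (exp_neg_mem_Icc hs))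

lemma heatSum_add {lam : ℕ → ℝ} (h0 : ∀ k, 0 ≤ lam k) {t : ℝ} (ht : 0 < t)
    (hsum : Summable fun k => Real.exp (-t * lam k)) {f g : ℝ → ℝ}
    (hf : Continuous f) (hg : Continuous g) :
    heatSum lam (fun x => f x + g x) t = heatSum lam f t + heatSum lam g t := by
  simp only [heatSum, mul_add]
  exact (summable_heatSum h0 ht hsum hf).tsum_add (summable_heatSum h0 ht hsum hg)

lemma gammaIntegral_add {a : ℝ} (ha : 0 < a) {f g : ℝ → ℝ}
    (hf : Continuous f) (hg : Continuous g) :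
    gammaIntegral a (fun x => f x + g x) = gammaIntegral a f + gammaIntegral a g := by
  simp only [gammaIntegral, mul_add]
  exact integral_add (integrableOn_gammaIntegral ha hf) (integrableOn_gammaIntegral ha hg)

lemma heatSum_mono {lam : ℕ → ℝ} (h0 : ∀ k, 0 ≤ lam k) {t : ℝ} (ht : 0 < t)
    (hsum : Summable fun k => Real.exp (-t * lam k)) {f g : ℝ → ℝ}
    (hf : Continuous f) (hg : Continuous g) (hfg : ∀ x ∈ Icc (0 : ℝ) 1, f x ≤ g x) :
    heatSum lam f t ≤ heatSum lam g t :=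
  (summable_heatSum h0 ht hsum hf).tsum_le_tsum
    (fun k => mul_le_mul_of_nonneg_left (hfg _ (exp_neg_mul_mem_Icc ht (h0 k)))
      (Real.exp_pos _).le) (summable_heatSum h0 ht hsum hg)

lemma gammaIntegral_mono {a : ℝ} (ha : 0 < a) {f g : ℝ → ℝ}
    (hf : Continuous f) (hg : Continuous g) (hfg : ∀ x ∈ Icc (0 : ℝ) 1, f x ≤ g x) :
    gammaIntegral a f ≤ gammaIntegral a g :=
  setIntegral_mono_on (integrableOn_gammaIntegral ha hf) (integrableOn_gammaIntegral ha hg)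
    measurableSet_Ioi fun _ hs => mul_le_mul_of_nonneg_left (hfg _ (exp_neg_mem_Icc hs))
      (mul_nonneg (Real.exp_pos _).le (Real.rpow_nonneg (le_of_lt hs) _))

lemma heatSum_const (lam : ℕ → ℝ) (c t : ℝ) :
    heatSum lam (fun _ => c) t = c * ∑' k, Real.exp (-t * lam k) := by
  simp only [heatSum, tsum_mul_right, mul_comm c]

lemma gammaIntegral_const {a : ℝ} (ha : 0 < a) (c : ℝ) :
    gammaIntegral a (fun _ => c) = c * Real.Gamma a := by
  simp only [gammaIntegral, integral_mul_const, Real.Gamma_eq_integral ha, mul_comm c]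

lemma gammaIntegral_monomial {a : ℝ} (ha : 0 < a) (m : ℕ) (c : ℝ) :
    gammaIntegral a (fun x => c * x ^ m) = c * ((1 / (m + 1 : ℝ)) ^ a * Real.Gamma a) := by
  rw [← Real.integral_rpow_mul_exp_neg_mul_Ioi ha (by positivity), gammaIntegral,
    ← integral_const_mul]
  refine setIntegral_congr_fun measurableSet_Ioi fun s _ => ?_
  have : Real.exp (-((m + 1 : ℝ) * s)) = Real.exp (-s) * Real.exp (-s) ^ m := by
    rw [← Real.exp_nat_mul, ← Real.exp_add]
    ring_nf
  simp only [this]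
  ring

lemma heatSum_monomial (lam : ℕ → ℝ) (m : ℕ) (c t : ℝ) :
    heatSum lam (fun x => c * x ^ m) t = c * ∑' k, Real.exp (-((m + 1 : ℝ) * t) * lam k) := by
  rw [heatSum, ← tsum_mul_left]
  refine tsum_congr fun k => ?_
  have : Real.exp (-((m + 1 : ℝ) * t) * lam k) =
      Real.exp (-t * lam k) * Real.exp (-t * lam k) ^ m := by
    rw [← Real.exp_nat_mul, ← Real.exp_add]
    ring_nf
  rw [this]
  ring

section Karamata

variable {lam : ℕ → ℝ} {a A : ℝ}

lemma tendsto_heatSum_monomial (ha : 0 < a)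
    (hheat : Tendsto (fun t : ℝ => t ^ a * ∑' k, Real.exp (-t * lam k)) (𝓝[>] 0) (𝓝 A))
    (m : ℕ) (c : ℝ) :
    Tendsto (fun t : ℝ => t ^ a * heatSum lam (fun x => c * x ^ m) t) (𝓝[>] 0)
      (𝓝 (A / Real.Gamma a * gammaIntegral a (fun x => c * x ^ m))) := by
  have hm : (0 : ℝ) < m + 1 := by positivity
  have hscale : Tendsto (fun t : ℝ => (m + 1 : ℝ) * t) (𝓝[>] 0) (𝓝[>] 0) := by
    refine tendsto_nhdsWithin_iff.2 ⟨?_, ?_⟩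
    · have : Tendsto (fun t : ℝ => (m + 1 : ℝ) * t) (𝓝 0) (𝓝 ((m + 1 : ℝ) * 0)) :=
        tendsto_id.const_mul _
      rw [mul_zero] at this
      exact this.mono_left nhdsWithin_le_nhds
    · filter_upwards [self_mem_nhdsWithin] with t ht
      exact mul_pos hm ht
  have key := ((hheat.comp hscale).const_mul (c * (1 / (m + 1 : ℝ)) ^ a))
  have hG := (Real.Gamma_pos_of_pos ha).ne'
  rw [gammaIntegral_monomial ha]
  have hlim : A / Real.Gamma a * (c * ((1 / (m + 1 : ℝ)) ^ a * Real.Gamma a)) =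
      c * (1 / (m + 1 : ℝ)) ^ a * A := by
    field_simp
  rw [hlim]
  refine key.congr' ?_
  filter_upwards [self_mem_nhdsWithin] with t ht
  have h1 : (1 / (m + 1 : ℝ)) ^ a * ((m + 1 : ℝ) * t) ^ a = t ^ a := by
    rw [← Real.mul_rpow (by positivity) (mul_pos hm ht).le]
    congr 1
    field_simp
  rw [heatSum_monomial, Function.comp_apply, ← h1]
  ring

lemma tendsto_heatSum_polynomial (ha : 0 < a) (h0 : ∀ k, 0 ≤ lam k)
    (hsum : ∀ t : ℝ, 0 < t → Summable fun k => Real.exp (-t * lam k))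
    (hheat : Tendsto (fun t : ℝ => t ^ a * ∑' k, Real.exp (-t * lam k)) (𝓝[>] 0) (𝓝 A))
    (p : Polynomial ℝ) :
    Tendsto (fun t : ℝ => t ^ a * heatSum lam (fun x => p.eval x) t) (𝓝[>] 0)
      (𝓝 (A / Real.Gamma a * gammaIntegral a (fun x => p.eval x))) := by
  induction p using Polynomial.induction_on' with
  | add p q hp hq =>
    simp only [Polynomial.eval_add]
    rw [gammaIntegral_add ha p.continuous q.continuous, mul_add]
    refine (hp.add hq).congr' ?_
    filter_upwards [self_mem_nhdsWithin] with t ht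
    rw [heatSum_add h0 ht (hsum t ht) p.continuous q.continuous, mul_add]
  | monomial m c =>
    simpa only [Polynomial.eval_monomial] using tendsto_heatSum_monomial ha hheat m c

lemma tendsto_heatSum_continuous (ha : 0 < a) (h0 : ∀ k, 0 ≤ lam k) (hA : 0 ≤ A)
    (hsum : ∀ t : ℝ, 0 < t → Summable fun k => Real.exp (-t * lam k))
    (hheat : Tendsto (fun t : ℝ => t ^ a * ∑' k, Real.exp (-t * lam k)) (𝓝[>] 0) (𝓝 A))
    {g : ℝ → ℝ} (hg : Continuous g) :
    Tendsto (fun t : ℝ => t ^ a * heatSum lam g t) (𝓝[>] 0)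
      (𝓝 (A / Real.Gamma a * gammaIntegral a g)) := by
  have hG := Real.Gamma_pos_of_pos ha
  rw [Metric.tendsto_nhds]
  intro ε hε
  set η : ℝ := ε / (2 * A + 3) with hη
  have hη0 : 0 < η := by positivity
  obtain ⟨p, hp⟩ := exists_polynomial_near_of_continuousOn 0 1 g hg.continuousOn η hη0
  have hpc : Continuous fun x => p.eval x := p.continuous
  have hcc : ∀ c : ℝ, Continuous fun _ : ℝ => c := fun c => continuous_const
  have hle : ∀ x ∈ Icc (0 : ℝ) 1, g x ≤ p.eval x + η := fun x hx => by
    have := abs_lt.1 (hp x hx); linarith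
  have hge : ∀ x ∈ Icc (0 : ℝ) 1, p.eval x ≤ g x + η := fun x hx => by
    have := abs_lt.1 (hp x hx); linarith
  have hI : ∀ {x y : ℝ}, x ≤ y + η * Real.Gamma a →
      A / Real.Gamma a * x ≤ A / Real.Gamma a * y + A * η := fun {x y} h => by
    calc _ ≤ A / Real.Gamma a * (y + η * Real.Gamma a) := by gcongr
      _ = _ := by field_simp
  have hI1 := gammaIntegral_mono ha hg (g := fun x => p.eval x + η) (hpc.add (hcc η)) hle
  rw [gammaIntegral_add ha hpc (hcc η), gammaIntegral_const ha] at hI1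
  have hI2 := gammaIntegral_mono ha hpc (g := fun x => g x + η) (hg.add (hcc η)) hge
  rw [gammaIntegral_add ha hg (hcc η), gammaIntegral_const ha] at hI2
  have hI1 := hI hI1
  have hI2 := hI hI2
  have hlimp := Metric.tendsto_nhds.1 (tendsto_heatSum_polynomial ha h0 hsum hheat p) η hη0
  have hlim1 := Metric.tendsto_nhds.1 hheat 1 one_pos
  filter_upwards [hlimp, hlim1, self_mem_nhdsWithin] with t hpt h1t ht
  have ht' : 0 < t ^ a := Real.rpow_pos_of_pos ht a
  have hS1 := heatSum_mono h0 ht (hsum t ht) hg (g := fun x => p.eval x + η)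
    (hpc.add (hcc η)) hle
  rw [heatSum_add h0 ht (hsum t ht) hpc (hcc η), heatSum_const] at hS1
  have hS2 := heatSum_mono h0 ht (hsum t ht) hpc (g := fun x => g x + η)
    (hg.add (hcc η)) hge
  rw [heatSum_add h0 ht (hsum t ht) hg (hcc η), heatSum_const] at hS2
  have hS1 := mul_le_mul_of_nonneg_left hS1 ht'.le
  have hS2 := mul_le_mul_of_nonneg_left hS2 ht'.le
  rw [Real.dist_eq, abs_lt] at hpt h1t ⊢
  have h1 : η * (t ^ a * ∑' k, Real.exp (-t * lam k)) ≤ η * (A + 1) :=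
    mul_le_mul_of_nonneg_left (by linarith) hη0.le
  have hε' : η * (2 * A + 3) = ε := by rw [hη]; field_simp
  constructor <;> nlinarith

/-- A continuous function squeezed between `x⁻¹ 𝟙_{x ≥ c}` and `x⁻¹ 𝟙_{x ≥ b}`. -/
noncomputable def invRamp (b c x : ℝ) : ℝ :=
  max 0 (min 1 ((x - b) / (c - b))) / max x b

lemma continuous_invRamp {b c : ℝ} (hb : 0 < b) : Continuous (invRamp b c) := by
  unfold invRamp
  refine Continuous.div (by fun_prop) (by fun_prop) fun x => ?_
  exact (lt_max_of_lt_right hb).ne'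

lemma mul_invRamp_nonneg {b c x : ℝ} (hx : 0 < x) : 0 ≤ x * invRamp b c x :=
  mul_nonneg hx.le (div_nonneg (le_max_left _ _) (hx.le.trans (le_max_left _ _)))

lemma mul_invRamp_le_one {b c x : ℝ} (hx : 0 < x) : x * invRamp b c x ≤ 1 := by
  have hm : 0 < max x b := lt_max_of_lt_left hx
  rw [invRamp, ← mul_div_assoc, div_le_one hm]
  calc x * max 0 (min 1 ((x - b) / (c - b))) ≤ x * 1 :=
        mul_le_mul_of_nonneg_left (max_le zero_le_one (min_le_left _ _)) hx.le
    _ ≤ max x b := by simp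

lemma invRamp_eq_zero {b c x : ℝ} (hbc : b < c) (hx : x ≤ b) : invRamp b c x = 0 := by
  have : (x - b) / (c - b) ≤ 0 := div_nonpos_of_nonpos_of_nonneg (by linarith) (by linarith)
  rw [invRamp, max_eq_left ((min_le_right _ _).trans this), zero_div]

lemma mul_invRamp_eq_one {b c x : ℝ} (hb : 0 < b) (hbc : b < c) (hx : c ≤ x) :
    x * invRamp b c x = 1 := by
  have : 1 ≤ (x - b) / (c - b) := by
    rw [one_le_div (by linarith)]
    linarith
  have hx0 : x ≠ 0 := by linarith
  rw [invRamp, min_eq_left this, max_eq_right zero_le_one, max_eq_left (by linarith)]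
  field_simp

lemma setIntegral_Ioc_rpow_sub_one {u : ℝ} (ha : 0 < a) (hu : 0 ≤ u) :
    ∫ s in Ioc 0 u, s ^ (a - 1) = u ^ a / a := by
  rw [← intervalIntegral.integral_of_le hu, integral_rpow (Or.inl (by linarith))]
  simp [Real.zero_rpow ha.ne']

lemma integrableOn_Ioc_rpow_sub_one {u : ℝ} (ha : 0 < a) (hu : 0 ≤ u) :
    IntegrableOn (fun s : ℝ => s ^ (a - 1)) (Ioc 0 u) :=
  (intervalIntegrable_iff_integrableOn_Ioc_of_le hu).1
    (intervalIntegral.intervalIntegrable_rpow' (by linarith))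

lemma gammaIntegral_invRamp_le {u v : ℝ} (ha : 0 < a) (hu : 0 ≤ u) (huv : u < v) :
    gammaIntegral a (invRamp (Real.exp (-v)) (Real.exp (-u))) ≤ v ^ a / a := by
  have hv : 0 ≤ v := hu.trans huv.le
  have hbc : Real.exp (-v) < Real.exp (-u) := Real.exp_lt_exp.2 (by linarith)
  rw [← setIntegral_Ioc_rpow_sub_one ha hv, gammaIntegral,
    ← integral_indicator measurableSet_Ioi, ← integral_indicator measurableSet_Ioc]
  refine integral_mono
    ((integrableOn_gammaIntegral ha (continuous_invRamp (Real.exp_pos _))).integrable_indicator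
      measurableSet_Ioi)
    ((integrableOn_Ioc_rpow_sub_one ha hv).integrable_indicator measurableSet_Ioc) fun s => ?_
  by_cases hs : 0 < s
  · rw [indicator_of_mem (mem_Ioi.2 hs)]
    have hp : 0 ≤ s ^ (a - 1) := Real.rpow_nonneg hs.le _
    by_cases hsv : s ≤ v
    · rw [indicator_of_mem (mem_Ioc.2 ⟨hs, hsv⟩)]
      have := mul_invRamp_le_one (b := Real.exp (-v)) (c := Real.exp (-u)) (Real.exp_pos (-s))
      nlinarith
    · rw [invRamp_eq_zero hbc (Real.exp_le_exp.2 (by linarith)), mul_zero]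
      exact indicator_nonneg (fun x hx => Real.rpow_nonneg hx.1.le _) _
  · rw [indicator_of_notMem (by simpa using hs), indicator_of_notMem (fun h => hs h.1)]

lemma le_gammaIntegral_invRamp {u v : ℝ} (ha : 0 < a) (hu : 0 ≤ u) (huv : u < v) :
    u ^ a / a ≤ gammaIntegral a (invRamp (Real.exp (-v)) (Real.exp (-u))) := by
  have hbc : Real.exp (-v) < Real.exp (-u) := Real.exp_lt_exp.2 (by linarith)
  rw [← setIntegral_Ioc_rpow_sub_one ha hu, gammaIntegral,
    ← integral_indicator measurableSet_Ioi, ← integral_indicator measurableSet_Ioc]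
  refine integral_mono
    ((integrableOn_Ioc_rpow_sub_one ha hu).integrable_indicator measurableSet_Ioc)
    ((integrableOn_gammaIntegral ha (continuous_invRamp (Real.exp_pos _))).integrable_indicator
      measurableSet_Ioi) fun s => ?_
  by_cases hs : 0 < s
  · rw [indicator_of_mem (mem_Ioi.2 hs)]
    have hp : 0 ≤ s ^ (a - 1) := Real.rpow_nonneg hs.le _
    by_cases hsu : s ≤ u
    · rw [indicator_of_mem (mem_Ioc.2 ⟨hs, hsu⟩), mul_right_comm,
        mul_invRamp_eq_one (Real.exp_pos _) hbc (Real.exp_le_exp.2 (by linarith)), one_mul]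
    · rw [indicator_of_notMem (fun h => hsu h.2), mul_right_comm]
      exact mul_nonneg (mul_invRamp_nonneg (Real.exp_pos _)) hp
  · rw [indicator_of_notMem (fun h => hs h.1), indicator_of_notMem (by simpa using hs)]

lemma finite_setOf_le_of_tendsto_atTop (htop : Tendsto lam atTop atTop) (x : ℝ) :
    {k | lam k ≤ x}.Finite := by
  have := htop.eventually_gt_atTop x
  rw [← Nat.cofinite_eq_atTop, eventually_cofinite] at this
  simpa using this

lemma heatSum_invRamp_le {u v t : ℝ} (htop : Tendsto lam atTop atTop) (ht : 0 < t)
    (huv : u < v) :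
    heatSum lam (invRamp (Real.exp (-v)) (Real.exp (-u))) t ≤
      (Nat.card {k : ℕ | lam k ≤ v / t} : ℝ) := by
  have hbc : Real.exp (-v) < Real.exp (-u) := Real.exp_lt_exp.2 (by linarith)
  have hfin := finite_setOf_le_of_tendsto_atTop htop (v / t)
  rw [Nat.card_coe_set_eq, ncard_eq_toFinset_card _ hfin, heatSum,
    tsum_eq_sum (s := hfin.toFinset)]
  · rw [Finset.cast_card]
    exact Finset.sum_le_sum fun k _ => mul_invRamp_le_one (Real.exp_pos _)
  · intro k hk
    rw [Finite.mem_toFinset, mem_ofPred_eq, not_le, div_lt_iff₀ ht] at hk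
    rw [invRamp_eq_zero hbc (Real.exp_le_exp.2 (by linarith)), mul_zero]

lemma card_le_heatSum_invRamp {u v t : ℝ} (htop : Tendsto lam atTop atTop)
    (h0 : ∀ k, 0 ≤ lam k) (ht : 0 < t)
    (hsum : Summable fun k => Real.exp (-t * lam k)) (huv : u < v) :
    (Nat.card {k : ℕ | lam k ≤ u / t} : ℝ) ≤
      heatSum lam (invRamp (Real.exp (-v)) (Real.exp (-u))) t := by
  have hbc : Real.exp (-v) < Real.exp (-u) := Real.exp_lt_exp.2 (by linarith)
  have hfin := finite_setOf_le_of_tendsto_atTop htop (u / t)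
  rw [Nat.card_coe_set_eq, ncard_eq_toFinset_card _ hfin, Finset.cast_card]
  refine le_trans (Finset.sum_le_sum fun k hk => ?_)
    ((summable_heatSum h0 ht hsum (continuous_invRamp (Real.exp_pos _))).sum_le_tsum hfin.toFinset
      fun k _ => mul_invRamp_nonneg (Real.exp_pos _))
  rw [Finite.mem_toFinset, mem_ofPred_eq, le_div_iff₀ ht] at hk
  rw [mul_invRamp_eq_one (Real.exp_pos _) hbc (Real.exp_le_exp.2 (by linarith))]

/-- **Karamata's Tauberian theorem** for the counting function of a nonnegative sequence. -/
theorem tendsto_rpow_mul_card_of_heat_trace (ha : 0 < a) (h0 : ∀ k, 0 ≤ lam k) (hA : 0 ≤ A)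
    (htop : Tendsto lam atTop atTop)
    (hsum : ∀ t : ℝ, 0 < t → Summable fun k => Real.exp (-t * lam k))
    (hheat : Tendsto (fun t : ℝ => t ^ a * ∑' k, Real.exp (-t * lam k)) (𝓝[>] 0) (𝓝 A)) :
    Tendsto (fun t : ℝ => t ^ a * (Nat.card {k : ℕ | lam k ≤ 1 / t} : ℝ)) (𝓝[>] 0)
      (𝓝 (A / Real.Gamma (a + 1))) := by
  have hG := Real.Gamma_pos_of_pos ha
  have hK : ∀ u : ℝ, A / Real.Gamma a * (u ^ a / a) = A / Real.Gamma (a + 1) * u ^ a := fun u => by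
    rw [Real.Gamma_add_one ha.ne']
    field_simp
  have hcont : Tendsto (fun u : ℝ => A / Real.Gamma (a + 1) * u ^ a) (𝓝 1)
      (𝓝 (A / Real.Gamma (a + 1))) := by
    have := ((Real.continuousAt_rpow_const 1 a (Or.inl one_ne_zero)).tendsto).const_mul
      (A / Real.Gamma (a + 1))
    simpa using this
  refine tendsto_order.2 ⟨fun y hy => ?_, fun y hy => ?_⟩
  · obtain ⟨u, hyu, hu0, hu1⟩ := (((hcont.mono_left nhdsWithin_le_nhds).eventually
      (lt_mem_nhds hy)).and (Ioo_mem_nhdsLT (zero_lt_one' ℝ))).exists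
    have hlim := tendsto_heatSum_continuous ha h0 hA hsum hheat
      (continuous_invRamp (c := Real.exp (-u)) (Real.exp_pos (-1)))
    have hlt : y < A / Real.Gamma a *
        gammaIntegral a (invRamp (Real.exp (-1)) (Real.exp (-u))) := by
      refine hyu.trans_le ?_
      rw [← hK]
      exact mul_le_mul_of_nonneg_left (le_gammaIntegral_invRamp ha hu0.le hu1) (by positivity)
    filter_upwards [hlim.eventually (lt_mem_nhds hlt), self_mem_nhdsWithin] with t hyt ht
    exact hyt.trans_le (mul_le_mul_of_nonneg_left (heatSum_invRamp_le htop ht hu1)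
      (Real.rpow_nonneg (le_of_lt ht) _))
  · obtain ⟨v, hyv, hv1⟩ := (((hcont.mono_left nhdsWithin_le_nhds).eventually
      (gt_mem_nhds hy)).and (self_mem_nhdsWithin (s := Ioi (1 : ℝ)))).exists
    have hlim := tendsto_heatSum_continuous ha h0 hA hsum hheat
      (continuous_invRamp (c := Real.exp (-1)) (Real.exp_pos (-v)))
    have hlt : A / Real.Gamma a *
        gammaIntegral a (invRamp (Real.exp (-v)) (Real.exp (-1))) < y := by
      refine lt_of_le_of_lt ?_ hyv
      rw [← hK]
      exact mul_le_mul_of_nonneg_left (gammaIntegral_invRamp_le ha zero_le_one hv1) (by positivity)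
    filter_upwards [hlim.eventually (gt_mem_nhds hlt), self_mem_nhdsWithin] with t hyt ht
    exact lt_of_le_of_lt (mul_le_mul_of_nonneg_left
      (card_le_heatSum_invRamp htop h0 ht (hsum t ht) hv1) (Real.rpow_nonneg (le_of_lt ht) _)) hyt

/-- Karamata's Tauberian theorem for the counting function of a sequence bounded below. -/
theorem tendsto_card_div_rpow_of_heat_trace (ha : 0 < a) (hA : 0 ≤ A)
    (hbd : BddBelow (Set.range lam)) (htop : Tendsto lam atTop atTop)
    (hsum : ∀ t : ℝ, 0 < t → Summable fun k => Real.exp (-t * lam k))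
    (hheat : Tendsto (fun t : ℝ => t ^ a * ∑' k, Real.exp (-t * lam k)) (𝓝[>] 0) (𝓝 A)) :
    Tendsto (fun x : ℝ => (Nat.card {k : ℕ | lam k ≤ x} : ℝ) / x ^ a) atTop
      (𝓝 (A / Real.Gamma (a + 1))) := by
  obtain ⟨m, hm⟩ := hbd
  have hexp : ∀ t k, Real.exp (-t * (lam k - m)) = Real.exp (t * m) * Real.exp (-t * lam k) :=
    fun t k => by rw [← Real.exp_add]; ring_nf
  have hheat' : Tendsto (fun t : ℝ => t ^ a * ∑' k, Real.exp (-t * (lam k - m)))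
      (𝓝[>] 0) (𝓝 A) := by
    have h1 : Tendsto (fun t : ℝ => Real.exp (t * m)) (𝓝[>] 0) (𝓝 1) := by
      have : Tendsto (fun t : ℝ => Real.exp (t * m)) (𝓝 0) (𝓝 (Real.exp (0 * m))) :=
        Continuous.tendsto (by fun_prop) 0
      rw [zero_mul, Real.exp_zero] at this
      exact this.mono_left nhdsWithin_le_nhds
    have h2 := h1.mul hheat
    rw [one_mul] at h2
    refine h2.congr fun t => ?_
    simp only [hexp, tsum_mul_left]
    ring
  have hshift := tendsto_rpow_mul_card_of_heat_trace (lam := fun k => lam k - m) ha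
    (fun k => sub_nonneg.2 (hm ⟨k, rfl⟩)) hA (tendsto_atTop_add_const_right _ (-m) htop)
    (fun t ht => by simpa only [hexp] using (hsum t ht).mul_left _) hheat'
  have hsub : Tendsto (fun x : ℝ => x - m) atTop atTop :=
    tendsto_atTop_add_const_right _ (-m) tendsto_id
  have hcomp := hshift.comp (tendsto_inv_atTop_nhdsGT_zero.comp hsub)
  have hratio : Tendsto (fun x : ℝ => ((x - m) / x) ^ a) atTop (𝓝 1) := by
    have h1 : Tendsto (fun x : ℝ => 1 - m * x⁻¹) atTop (𝓝 (1 - m * 0)) :=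
      (tendsto_inv_atTop_zero.const_mul m).const_sub 1
    rw [mul_zero, sub_zero] at h1
    have h2 := h1.rpow_const (p := a) (Or.inl one_ne_zero)
    rw [Real.one_rpow] at h2
    refine h2.congr' ?_
    filter_upwards [eventually_gt_atTop 0] with x hx
    congr 1
    field_simp
  have hprod := hcomp.mul hratio
  rw [mul_one] at hprod
  refine hprod.congr' ?_
  filter_upwards [eventually_gt_atTop 0, eventually_gt_atTop m] with x hx hxm
  have hxm' : 0 < x - m := sub_pos.2 hxm
  have hpos := Real.rpow_pos_of_pos hxm' a
  simp only [Function.comp_apply, one_div, inv_inv, sub_le_sub_iff_right]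
  rw [Real.inv_rpow hxm'.le, Real.div_rpow hxm'.le hx.le]
  field_simp

end Karamata

/-- Weyl's law from heat trace asymptotics (abstract form). -/
theorem weyl_law_from_heat_trace
    (n : ℕ) (hn : 2 ≤ n) (V₀ : ℝ) (hV₀ : 0 < V₀)
    (lam : ℕ → ℝ)
    (hbd : BddBelow (Set.range lam))
    (htop : Tendsto lam atTop atTop)
    (hsum : ∀ t : ℝ, 0 < t → Summable (fun k : ℕ => Real.exp (-t * lam k)))
    (hheat : Tendsto
      (fun t : ℝ => t ^ ((n : ℝ) / 2) * ∑' k : ℕ, Real.exp (-t * lam k))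
      (𝓝[>] 0) (𝓝 (V₀ / (4 * Real.pi) ^ ((n : ℝ) / 2)))) :
    Tendsto
      (fun Λ : ℝ => (Nat.card {k : ℕ | lam k ≤ Λ} : ℝ) * (2 * Real.pi) ^ n /
        (Λ ^ ((n : ℝ) / 2) *
          (Real.pi ^ ((n : ℝ) / 2) / Real.Gamma ((n : ℝ) / 2 + 1))))
      atTop (𝓝 V₀) := by
  have ha : (0 : ℝ) < (n : ℝ) / 2 := by
    have : (0 : ℝ) < n := by exact_mod_cast (by omega : 0 < n)
    positivity
  have hG := Real.Gamma_pos_of_pos (show 0 < (n : ℝ) / 2 + 1 by linarith)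
  have hpi := Real.pi_pos
  have h4 : 0 < (4 * Real.pi) ^ ((n : ℝ) / 2) := by positivity
  have hp : 0 < Real.pi ^ ((n : ℝ) / 2) := by positivity
  have hpow : (2 * Real.pi) ^ n = (4 * Real.pi) ^ ((n : ℝ) / 2) * Real.pi ^ ((n : ℝ) / 2) := by
    rw [← Real.mul_rpow (by positivity) hpi.le,
      show 4 * Real.pi * Real.pi = (2 * Real.pi) ^ (2 : ℝ) by norm_cast; ring,
      ← Real.rpow_mul (by positivity), mul_div_cancel₀ _ (two_ne_zero' ℝ), Real.rpow_natCast]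
  have hlim := (tendsto_card_div_rpow_of_heat_trace ha (by positivity) hbd htop hsum
    hheat).mul_const ((2 * Real.pi) ^ n * Real.Gamma ((n : ℝ) / 2 + 1) / Real.pi ^ ((n : ℝ) / 2))
  have hV : V₀ / (4 * Real.pi) ^ ((n : ℝ) / 2) / Real.Gamma ((n : ℝ) / 2 + 1) *
      ((2 * Real.pi) ^ n * Real.Gamma ((n : ℝ) / 2 + 1) / Real.pi ^ ((n : ℝ) / 2)) = V₀ := by
    rw [hpow, div_div, div_mul_div_comm, div_eq_iff (by positivity)]
    ring
  rw [hV] at hlim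
  refine hlim.congr fun x => ?_
  rw [div_mul_div_comm, mul_div_assoc', div_div_eq_mul_div, mul_assoc]
end

section
/- Averaged monotone spectral limit: Let (a_k)_{k≥1} be a sequence of non-negative reals with Σ_k a_k < ∞, and let (λ_k)_{k≥1} be a sequence of non-negative reals. Then lim_{t→0⁺} (1/t) Σ_{k≥1} a_k (1 − ∫₀¹ e^{-λ_k t v(1-v)} dv) = (1/6) Σ_{k≥1} λ_k a_k, where both sides are taken as values in the extended non-negative reals [0,∞]. -/
open MeasureTheory Filter Topology Set

/-- Second-order Taylor upper bound for `exp (-y)` with `0 ≤ y`. -/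
lemma Real.exp_neg_le_quadratic {y : ℝ} (hy : 0 ≤ y) :
    Real.exp (-y) ≤ 1 - y + y ^ 2 / 2 := by
  have h := Real.quadratic_le_exp_of_nonneg hy
  have hpos : 0 < 1 - y + y ^ 2 / 2 := by nlinarith [sq_nonneg (y - 1)]
  rw [Real.exp_neg]
  refine inv_le_of_inv_le₀ hpos (le_trans ?_ h)
  rw [inv_le_iff_one_le_mul₀ hpos]
  nlinarith [sq_nonneg (y ^ 2)]

lemma integral_const_sub_mul_add_mul_sq (c x : ℝ) :
    ∫ v in (0:ℝ)..1, (c - x * v + x * v ^ 2) = c - x / 6 := by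
  rw [intervalIntegral.integral_add (Continuous.intervalIntegrable (by fun_prop) _ _)
      (Continuous.intervalIntegrable (by fun_prop) _ _),
    intervalIntegral.integral_sub (Continuous.intervalIntegrable (by fun_prop) _ _)
      (Continuous.intervalIntegrable (by fun_prop) _ _),
    intervalIntegral.integral_const_mul x fun v : ℝ => v,
    intervalIntegral.integral_const_mul, integral_pow, integral_id,
    intervalIntegral.integral_const, smul_eq_mul]
  ring

lemma one_sub_integral_exp_le (x : ℝ) :
    1 - ∫ v in (0:ℝ)..1, Real.exp (-(x * v * (1 - v))) ≤ x / 6 := by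
  have h : ∫ v in (0:ℝ)..1, (1 - x * v + x * v ^ 2) ≤
      ∫ v in (0:ℝ)..1, Real.exp (-(x * v * (1 - v))) := by
    refine intervalIntegral.integral_mono_on zero_le_one
      (Continuous.intervalIntegrable (by fun_prop) _ _)
      (Continuous.intervalIntegrable (by fun_prop) _ _) fun v _ => ?_
    linarith [Real.add_one_le_exp (-(x * v * (1 - v)))]
  linarith [integral_const_sub_mul_add_mul_sq 1 x]

lemma le_one_sub_integral_exp {x : ℝ} (hx : 0 ≤ x) :
    x / 6 - x ^ 2 / 2 ≤ 1 - ∫ v in (0:ℝ)..1, Real.exp (-(x * v * (1 - v))) := by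
  have h : ∫ v in (0:ℝ)..1, Real.exp (-(x * v * (1 - v))) ≤
      ∫ v in (0:ℝ)..1, (1 + x ^ 2 / 2 - x * v + x * v ^ 2) := by
    refine intervalIntegral.integral_mono_on zero_le_one
      (Continuous.intervalIntegrable (by fun_prop) _ _)
      (Continuous.intervalIntegrable (by fun_prop) _ _) fun v hv => ?_
    have h0 : 0 ≤ v * (1 - v) := mul_nonneg hv.1 (sub_nonneg.2 hv.2)
    have h1 : v * (1 - v) ≤ 1 := by nlinarith [sq_nonneg v, hv.2]
    have h2 : (x * (v * (1 - v))) ^ 2 ≤ x ^ 2 :=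
      pow_le_pow_left₀ (mul_nonneg hx h0) (mul_le_of_le_one_right hx h1) 2
    have h3 := Real.exp_neg_le_quadratic (mul_nonneg hx h0)
    rw [mul_assoc]
    linarith
  linarith [integral_const_sub_mul_add_mul_sq (1 + x ^ 2 / 2) x]

/-- The difference quotient at `0` of the averaged exponential tends to `l / 6`. -/
lemma tendsto_one_sub_integral_exp_div {l : ℝ} (hl : 0 ≤ l) :
    Tendsto (fun t : ℝ => 1 / t * (1 - ∫ v in (0:ℝ)..1, Real.exp (-(l * t * v * (1 - v)))))
      (𝓝[>] 0) (𝓝 (l / 6)) := by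
  have hlow : Tendsto (fun t : ℝ => l / 6 - l ^ 2 * t / 2) (𝓝[>] 0) (𝓝 (l / 6)) := by
    have h : Continuous fun t : ℝ => l / 6 - l ^ 2 * t / 2 := by fun_prop
    simpa using (h.tendsto 0).mono_left nhdsWithin_le_nhds
  refine tendsto_of_tendsto_of_tendsto_of_le_of_le' hlow tendsto_const_nhds ?_ ?_ <;>
    filter_upwards [self_mem_nhdsWithin] with t (ht : 0 < t) <;>
    rw [one_div_mul_eq_div]
  · rw [le_div_iff₀ ht]
    linarith [le_one_sub_integral_exp (mul_nonneg hl ht.le)]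
  · rw [div_le_iff₀ ht]
    linarith [one_sub_integral_exp_le (l * t)]

/-- Termwise convergence from below passes to sums in `[0, ∞]`. -/
lemma ENNReal.tendsto_tsum_of_le {ι α : Type*} {F : Filter α} {f : α → ι → ENNReal}
    {g : ι → ENNReal} (hle : ∀ᶠ t in F, ∀ i, f t i ≤ g i)
    (hlim : ∀ i, Tendsto (fun t => f t i) F (𝓝 (g i))) :
    Tendsto (fun t => ∑' i, f t i) F (𝓝 (∑' i, g i)) := by
  refine tendsto_order.2 ⟨fun c hc => ?_, fun c hc => ?_⟩
  · rw [ENNReal.tsum_eq_iSup_sum, lt_iSup_iff] at hc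
    obtain ⟨s, hs⟩ := hc
    filter_upwards [(tendsto_finsetSum s fun i _ => hlim i).eventually_const_lt hs] with t ht
    exact ht.trans_le (ENNReal.sum_le_tsum s)
  · filter_upwards [hle] with t ht
    exact (ENNReal.tsum_le_tsum ht).trans_lt hc

/-- Averaged monotone spectral limit, with values in the extended non-negative reals. -/
theorem averaged_monotone_spectral_limit
    (a lam : ℕ → ℝ) (ha : ∀ k, 0 ≤ a k) (hlam : ∀ k, 0 ≤ lam k)
    (hsum : Summable a) :
    Tendsto
      (fun t : ℝ => ENNReal.ofReal (1 / t) *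
        ∑' k : ℕ, ENNReal.ofReal
          (a k * (1 - ∫ v in (0:ℝ)..1, Real.exp (-(lam k * t * v * (1 - v))))))
      (𝓝[>] 0)
      (𝓝 ((1 / 6 : ENNReal) * ∑' k : ℕ, ENNReal.ofReal (lam k * a k))) := by
  have h6 : (1 / 6 : ENNReal) = ENNReal.ofReal (1 / 6) := by
    rw [ENNReal.ofReal_div_of_pos (by norm_num)]
    simp
  simp_rw [h6, ← ENNReal.tsum_mul_left]
  refine ENNReal.tendsto_tsum_of_le ?_ fun k => ?_
  · filter_upwards [self_mem_nhdsWithin] with t (ht : 0 < t) k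
    rw [← ENNReal.ofReal_mul (by positivity), ← ENNReal.ofReal_mul (by positivity)]
    refine ENNReal.ofReal_le_ofReal ?_
    rw [one_div_mul_eq_div, div_le_iff₀ ht]
    linarith [mul_le_mul_of_nonneg_left (one_sub_integral_exp_le (lam k * t)) (ha k)]
  · rw [← ENNReal.ofReal_mul (by positivity)]
    have h := ENNReal.tendsto_ofReal
      ((tendsto_one_sub_integral_exp_div (hlam k)).const_mul (a k))
    rw [show 1 / 6 * (lam k * a k) = a k * (lam k / 6) by ring]
    refine h.congr' ?_
    filter_upwards [self_mem_nhdsWithin] with t (ht : 0 < t)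
    rw [← ENNReal.ofReal_mul (by positivity), mul_left_comm]
end

section
/- Spectral characterization of H¹ regularity (abstract core of Proposition 3.1 and Theorem 1.3): Let (a_k)_{k≥1} be a sequence of non-negative reals with Σ_k a_k < ∞, and let (λ_k)_{k≥1} be a sequence of non-negative reals. Define, for t > 0, Φ(t) = Σ_{k≥1} a_k ∫₀¹ e^{-λ_k t v(1-v)} dv. Then the quotient (1/t)·(Σ_k a_k − Φ(t)) remains bounded as t → 0⁺ if and only if Σ_{k≥1} λ_k a_k < ∞; and in that case lim_{t→0⁺} (1/t)(Σ_k a_k − Φ(t)) = (1/6) Σ_{k≥1} λ_k a_k. -/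
open MeasureTheory Filter Topology Set

lemma Real.exp_neg_le_one_sub_add_sq {y : ℝ} (hy : 0 ≤ y) : Real.exp (-y) ≤ 1 - y + y ^ 2 := by
  have h : 1 + y ≤ Real.exp y := by linarith [Real.add_one_le_exp y]
  rw [Real.exp_neg]
  refine (inv_anti₀ (by positivity) h).trans ?_
  rw [inv_le_iff_one_le_mul₀ (by positivity)]
  nlinarith [pow_nonneg hy 3]

lemma integral_mul_one_sub : ∫ v in (0:ℝ)..1, v * (1 - v) = 1 / 6 := by
  have h : (fun v : ℝ => v * (1 - v)) = fun v => v - v ^ 2 := by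
    funext v
    ring
  rw [h, intervalIntegral.integral_sub (by simp) (by simp), integral_id, integral_pow]
  norm_num

lemma intervalIntegrable_exp_neg_mul_one_sub (x : ℝ) :
    IntervalIntegrable (fun v : ℝ => Real.exp (-(x * v * (1 - v)))) volume 0 1 :=
  Continuous.intervalIntegrable (by fun_prop) _ _

lemma integral_exp_neg_mul_one_sub_le_one {x : ℝ} (hx : 0 ≤ x) :
    ∫ v in (0:ℝ)..1, Real.exp (-(x * v * (1 - v))) ≤ 1 := by
  have h := intervalIntegral.integral_mono_on (μ := volume) (zero_le_one' ℝ)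
    (intervalIntegrable_exp_neg_mul_one_sub x) (intervalIntegrable_const (c := (1 : ℝ)))
    (fun v hv => by
      have : 0 ≤ x * v * (1 - v) := mul_nonneg (mul_nonneg hx hv.1) (sub_nonneg.2 hv.2)
      exact Real.exp_le_one_iff.2 (by linarith))
  simpa using h

lemma one_sub_div_six_le_integral_exp_neg (x : ℝ) :
    1 - x / 6 ≤ ∫ v in (0:ℝ)..1, Real.exp (-(x * v * (1 - v))) := by
  have h := intervalIntegral.integral_mono_on (μ := volume) (zero_le_one' ℝ)
    (f := fun v : ℝ => 1 - x * (v * (1 - v)))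
    (Continuous.intervalIntegrable (by fun_prop) _ _)
    (intervalIntegrable_exp_neg_mul_one_sub x)
    (fun v _ => by nlinarith [Real.add_one_le_exp (-(x * v * (1 - v)))])
  rw [intervalIntegral.integral_sub (by simp) (Continuous.intervalIntegrable (by fun_prop) _ _),
    intervalIntegral.integral_const_mul, integral_mul_one_sub] at h
  simp only [intervalIntegral.integral_const, smul_eq_mul] at h
  linarith

lemma integral_exp_neg_le_one_sub_div_six_add_sq {x : ℝ} (hx : 0 ≤ x) :
    ∫ v in (0:ℝ)..1, Real.exp (-(x * v * (1 - v))) ≤ 1 - x / 6 + x ^ 2 := by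
  have h := intervalIntegral.integral_mono_on (μ := volume) (zero_le_one' ℝ)
    (g := fun v : ℝ => (1 + x ^ 2) - x * (v * (1 - v)))
    (intervalIntegrable_exp_neg_mul_one_sub x)
    (Continuous.intervalIntegrable (by fun_prop) _ _)
    (fun v hv => by
      have hw : 0 ≤ v * (1 - v) := mul_nonneg hv.1 (sub_nonneg.2 hv.2)
      have hw1 : v * (1 - v) ≤ 1 := by nlinarith [sq_nonneg v, hv.2]
      have hy : 0 ≤ x * v * (1 - v) := by
        rw [mul_assoc]
        exact mul_nonneg hx hw
      have hyx : x * v * (1 - v) ≤ x := by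
        rw [mul_assoc]
        exact mul_le_of_le_one_right hx hw1
      have hsq : (x * v * (1 - v)) ^ 2 ≤ x ^ 2 := pow_le_pow_left₀ hy hyx 2
      linarith [Real.exp_neg_le_one_sub_add_sq hy])
  rw [intervalIntegral.integral_sub (by simp) (Continuous.intervalIntegrable (by fun_prop) _ _),
    intervalIntegral.integral_const_mul, integral_mul_one_sub] at h
  simp only [intervalIntegral.integral_const, smul_eq_mul] at h
  linarith

lemma one_sub_integral_exp_neg_div_nonneg {c t : ℝ} (hc : 0 ≤ c) (ht : 0 < t) :
    0 ≤ (1 - ∫ v in (0:ℝ)..1, Real.exp (-(c * t * v * (1 - v)))) / t :=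
  div_nonneg (sub_nonneg.2 (integral_exp_neg_mul_one_sub_le_one (by positivity))) ht.le

lemma one_sub_integral_exp_neg_div_le (c : ℝ) {t : ℝ} (ht : 0 < t) :
    (1 - ∫ v in (0:ℝ)..1, Real.exp (-(c * t * v * (1 - v)))) / t ≤ c / 6 := by
  rw [div_le_iff₀ ht]
  linarith [one_sub_div_six_le_integral_exp_neg (c * t)]

lemma tendsto_one_sub_integral_exp_neg_div {c : ℝ} (hc : 0 ≤ c) :
    Tendsto (fun t : ℝ => (1 - ∫ v in (0:ℝ)..1, Real.exp (-(c * t * v * (1 - v)))) / t)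
      (𝓝[>] 0) (𝓝 (c / 6)) := by
  have hlow : Tendsto (fun t : ℝ => c / 6 - c ^ 2 * t) (𝓝[>] 0) (𝓝 (c / 6)) := by
    have h : Continuous fun t : ℝ => c / 6 - c ^ 2 * t := by fun_prop
    simpa using (h.tendsto 0).mono_left nhdsWithin_le_nhds
  refine tendsto_of_tendsto_of_tendsto_of_le_of_le' hlow tendsto_const_nhds ?_ ?_
  · filter_upwards [self_mem_nhdsWithin] with t ht
    have ht : 0 < t := ht
    rw [le_div_iff₀ ht]
    nlinarith [integral_exp_neg_le_one_sub_div_six_add_sq (mul_nonneg hc ht.le)]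
  · filter_upwards [self_mem_nhdsWithin] with t ht
    exact one_sub_integral_exp_neg_div_le c ht

lemma hasSum_mul_one_sub_integral_exp_neg_div {a lam : ℕ → ℝ} (ha : ∀ k, 0 ≤ a k)
    (hlam : ∀ k, 0 ≤ lam k) (hsum : Summable a) {t : ℝ} (ht : 0 < t) :
    HasSum (fun k => a k * ((1 - ∫ v in (0:ℝ)..1, Real.exp (-(lam k * t * v * (1 - v)))) / t))
      ((1 / t) * ((∑' k : ℕ, a k) -
        ∑' k : ℕ, a k * ∫ v in (0:ℝ)..1, Real.exp (-(lam k * t * v * (1 - v))))) := by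
  have hs : Summable fun k => a k * ∫ v in (0:ℝ)..1, Real.exp (-(lam k * t * v * (1 - v))) := by
    refine Summable.of_nonneg_of_le (fun k => mul_nonneg (ha k) ?_) (fun k => ?_) hsum
    · exact intervalIntegral.integral_nonneg zero_le_one fun v _ => (Real.exp_pos _).le
    · exact mul_le_of_le_one_right (ha k)
        (integral_exp_neg_mul_one_sub_le_one (mul_nonneg (hlam k) ht.le))
  have h := (hsum.hasSum.sub hs.hasSum).mul_left (1 / t)
  refine (congrArg (HasSum · _) (funext fun k => ?_)).mp h
  ring

/-- Spectral characterization of H¹ regularity. -/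
theorem spectral_characterization_H1
    (a lam : ℕ → ℝ) (ha : ∀ k, 0 ≤ a k) (hlam : ∀ k, 0 ≤ lam k)
    (hsum : Summable a) :
    ((∃ C : ℝ, ∀ᶠ t in 𝓝[>] (0:ℝ),
        |(1 / t) * ((∑' k : ℕ, a k) -
          ∑' k : ℕ, a k * ∫ v in (0:ℝ)..1, Real.exp (-(lam k * t * v * (1 - v))))| ≤ C)
      ↔ Summable (fun k : ℕ => lam k * a k))
    ∧ (Summable (fun k : ℕ => lam k * a k) →
        Tendsto
          (fun t : ℝ => (1 / t) * ((∑' k : ℕ, a k) -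
            ∑' k : ℕ, a k * ∫ v in (0:ℝ)..1, Real.exp (-(lam k * t * v * (1 - v)))))
          (𝓝[>] 0) (𝓝 ((1 / 6) * ∑' k : ℕ, lam k * a k))) := by
  have hterm : ∀ k, Tendsto
      (fun t : ℝ => a k * ((1 - ∫ v in (0:ℝ)..1, Real.exp (-(lam k * t * v * (1 - v)))) / t))
      (𝓝[>] 0) (𝓝 ((1 / 6) * (lam k * a k))) := fun k => by
    convert (tendsto_one_sub_integral_exp_neg_div (hlam k)).const_mul (a k) using 2
    ring
  have hlim : Summable (fun k : ℕ => lam k * a k) →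
      Tendsto
        (fun t : ℝ => (1 / t) * ((∑' k : ℕ, a k) -
          ∑' k : ℕ, a k * ∫ v in (0:ℝ)..1, Real.exp (-(lam k * t * v * (1 - v)))))
        (𝓝[>] 0) (𝓝 ((1 / 6) * ∑' k : ℕ, lam k * a k)) := fun hS => by
    rw [← tsum_mul_left]
    refine (tendsto_tsum_of_dominated_convergence (hS.mul_left (1 / 6)) hterm ?_).congr' ?_
    · filter_upwards [self_mem_nhdsWithin] with t ht k
      rw [Real.norm_of_nonneg
        (mul_nonneg (ha k) (one_sub_integral_exp_neg_div_nonneg (hlam k) ht))]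
      calc _ ≤ a k * (lam k / 6) :=
            mul_le_mul_of_nonneg_left (one_sub_integral_exp_neg_div_le (lam k) ht) (ha k)
        _ = _ := by ring
    · filter_upwards [self_mem_nhdsWithin] with t ht
      exact (hasSum_mul_one_sub_integral_exp_neg_div ha hlam hsum ht).tsum_eq
  refine ⟨⟨?_, fun hS => ?_⟩, hlim⟩
  · rintro ⟨C, hC⟩
    refine (summable_mul_left_iff (by norm_num : (1 / 6 : ℝ) ≠ 0)).1
      (summable_of_sum_le (c := C)
        (fun k => mul_nonneg (by norm_num) (mul_nonneg (hlam k) (ha k))) fun s => ?_)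
    refine le_of_tendsto (tendsto_finsetSum s fun k _ => hterm k) ?_
    filter_upwards [hC, self_mem_nhdsWithin] with t hCt ht
    exact (sum_le_hasSum s
      (fun k _ => mul_nonneg (ha k) (one_sub_integral_exp_neg_div_nonneg (hlam k) ht))
      (hasSum_mul_one_sub_integral_exp_neg_div ha hlam hsum ht)).trans ((le_abs_self _).trans hCt)
  · exact ⟨_, (hlim hS).abs.eventually_le_const (lt_add_one _)⟩
end
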